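/- Let γ be a standard Gaussian random vector in ℝⁿ (i.e., with independent N(0,1) coordinates), let β ∈ (0,1), let t > 0, and let ū, v̄ ∈ ℝⁿ be unit vectors with ⟨ū, v̄⟩ ≤ β. Then Pr[⟨ū, γ⟩ ≥ t and ⟨v̄, γ⟩ ≥ t] ≤ Φ̄(t)^{2/(1+β)}. -/

import Mathlib

open ProbabilityTheory MeasureTheory

section Aux
open Set Filter Topology

lemma cdf_hasStrictDerivAt (x : ℝ) :
    HasStrictDerivAt (fun x => cdf (gaussianReal 0 1) x) (gaussianPDFReal 0 1 x) x := by
  have hc : Continuous (gaussianPDFReal 0 1) := by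
    rw [gaussianPDFReal_def]; fun_prop
  have h : (fun x => cdf (gaussianReal 0 1) x) =
      fun x => cdf (gaussianReal 0 1) 0 + ∫ y in (0:ℝ)..x, gaussianPDFReal 0 1 y := by
    funext x
    have key : ∀ a, cdf (gaussianReal 0 1) a = ∫ y in Iic a, gaussianPDFReal 0 1 y := by
      intro a
      rw [cdf_eq_real, Measure.real, gaussianReal_apply_eq_integral _ (by simp),
        ENNReal.toReal_ofReal]
      exact integral_nonneg (fun y => gaussianPDFReal_nonneg _ _ _)
    rw [key, key, ← intervalIntegral.integral_Iic_sub_Iic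
      (integrable_gaussianPDFReal 0 1).integrableOn (integrable_gaussianPDFReal 0 1).integrableOn]
    ring
  rw [h]
  exact (hc.integral_hasStrictDerivAt 0 x).const_add _

lemma cdf_strictMono : StrictMono (fun x => cdf (gaussianReal 0 1) x) := by
  apply strictMono_of_deriv_pos
  intro x
  rw [(cdf_hasStrictDerivAt x).hasDerivAt.deriv]
  exact gaussianPDFReal_pos _ _ _ (by simp)

lemma cdf_pos' (x : ℝ) : 0 < cdf (gaussianReal 0 1) x :=
  lt_of_le_of_lt (cdf_nonneg _ (x-1)) (cdf_strictMono (by linarith))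

lemma cdf_lt_one' (x : ℝ) : cdf (gaussianReal 0 1) x < 1 :=
  lt_of_lt_of_le (cdf_strictMono (show x < x + 1 by linarith)) (cdf_le_one _ (x+1))

lemma cdf_surj (v : ℝ) (h0 : 0 < v) (h1 : v < 1) : ∃ p, cdf (gaussianReal 0 1) p = v := by
  have hc : Continuous (fun x => cdf (gaussianReal 0 1) x) :=
    continuous_iff_continuousAt.2 fun x => (cdf_hasStrictDerivAt x).hasDerivAt.continuousAt
  obtain ⟨a, ha⟩ := ((tendsto_cdf_atBot (gaussianReal 0 1)).eventually (gt_mem_nhds h0)).exists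
  obtain ⟨b, hb⟩ := ((tendsto_cdf_atTop (gaussianReal 0 1)).eventually (lt_mem_nhds h1)).exists
  exact mem_range_of_exists_le_of_exists_ge hc ⟨a, ha.le⟩ ⟨b, hb.le⟩

lemma transport (t : ℝ) : ∃ T T' : ℝ → ℝ, StrictMonoOn T (Ioi t) ∧
    ∀ x ∈ Ioi t, HasDerivAt T (T' x) x ∧ 0 < T' x ∧
      Real.exp (-x^2/2) =
        (1 - cdf (gaussianReal 0 1) t) * T' x * Real.exp (-(T x)^2/2) := by
  set F : ℝ → ℝ := fun x => cdf (gaussianReal 0 1) x with hF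
  set G := Function.invFun F
  have hG : Function.LeftInverse G F := Function.leftInverse_invFun cdf_strictMono.injective
  have ht : 0 < 1 - F t := sub_pos.2 (cdf_lt_one' t)
  set v : ℝ → ℝ := fun x => 1 - (1 - F x) / (1 - F t) with hv
  have hvx : ∀ x ∈ Ioi t, F (G (v x)) = v x := by
    intro x hx
    have h1 : F t < F x := cdf_strictMono hx
    have h2 : F x < 1 := cdf_lt_one' x
    obtain ⟨p, hp⟩ := cdf_surj (v x)
      (by rw [hv]; simp only [sub_pos]; rw [div_lt_one ht]; linarith)
      (by rw [hv]; simp only; have : 0 < (1 - F x) / (1 - F t) := div_pos (by linarith) ht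
          linarith)
    have hp' : F p = v x := hp
    rw [← hp', hG]
  have hpdf : ∀ x, gaussianPDFReal 0 1 x = (Real.sqrt (2 * Real.pi))⁻¹ * Real.exp (-x^2/2) := by
    intro x; simp [gaussianPDFReal]
  refine ⟨fun x => G (v x), fun x => (gaussianPDFReal 0 1 (G (v x)))⁻¹ *
    (gaussianPDFReal 0 1 x / (1 - F t)), ?_, ?_⟩
  · intro x hx y hy hxy
    apply (cdf_strictMono.lt_iff_lt).1
    change F (G (v x)) < F (G (v y))
    rw [hvx x hx, hvx y hy]
    have : F x < F y := cdf_strictMono hxy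
    simp only [hv]
    gcongr
  · intro x hx
    have hp0 : 0 < gaussianPDFReal 0 1 (G (v x)) := gaussianPDFReal_pos _ _ _ (by simp)
    have hx0 : 0 < gaussianPDFReal 0 1 x := gaussianPDFReal_pos _ _ _ (by simp)
    refine ⟨?_, by positivity, ?_⟩
    · have h1 := (cdf_hasStrictDerivAt (G (v x))).to_local_left_inverse (g := G) hp0.ne'
        (Eventually.of_forall hG)
      have h1' : HasStrictDerivAt G (gaussianPDFReal 0 1 (G (v x)))⁻¹ (v x) := by
        rw [← hvx x hx]
        rw [hG]
        exact h1
      have h2 : HasDerivAt v (gaussianPDFReal 0 1 x / (1 - F t)) x := by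
        have := (((cdf_hasStrictDerivAt x).hasDerivAt.const_sub 1).div_const (1 - F t)).const_sub 1
        simpa [neg_div] using this
      exact h1'.hasDerivAt.comp x h2
    · change _ = (1 - F t) * ((gaussianPDFReal 0 1 (G (v x)))⁻¹ *
        (gaussianPDFReal 0 1 x / (1 - F t))) * Real.exp (-(G (v x))^2/2)
      rw [hpdf, hpdf]
      have : 0 < Real.sqrt (2 * Real.pi) := by positivity
      have := Real.exp_pos (-(G (v x))^2/2)
      field_simp

noncomputable def Th (r : ℝ) (T : ℝ → ℝ) (z : ℝ × ℝ) : ℝ × ℝ :=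
  ((T z.1 + r * T z.2 + r * (z.1 - z.2)) / (1 + r),
   (T z.2 + r * T z.1 - r * (z.1 - z.2)) / (1 + r))

noncomputable def Th' (r : ℝ) (T' : ℝ → ℝ) (z : ℝ × ℝ) : ℝ × ℝ →L[ℝ] ℝ × ℝ :=
  (Matrix.toLin (.finTwoProd ℝ) (.finTwoProd ℝ)
    !![(T' z.1 + r) / (1 + r), (r * T' z.2 - r) / (1 + r);
       (r * T' z.1 - r) / (1 + r), (T' z.2 + r) / (1 + r)]).toContinuousLinearMap

lemma Th_deriv (r : ℝ) (T T' : ℝ → ℝ) (z : ℝ × ℝ) (h1 : HasDerivAt T (T' z.1) z.1)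
    (h2 : HasDerivAt T (T' z.2) z.2) : HasFDerivAt (Th r T) (Th' r T' z) z := by
  unfold Th'
  rw [Matrix.toLin_finTwoProd_toContinuousLinearMap]
  have a1 : HasFDerivAt (fun z : ℝ × ℝ => T z.1)
      (T' z.1 • ContinuousLinearMap.fst ℝ ℝ ℝ) z := h1.comp_hasFDerivAt z hasFDerivAt_fst
  have a2 : HasFDerivAt (fun z : ℝ × ℝ => T z.2)
      (T' z.2 • ContinuousLinearMap.snd ℝ ℝ ℝ) z := h2.comp_hasFDerivAt z hasFDerivAt_snd
  have a3 : HasFDerivAt (fun z : ℝ × ℝ => z.1 - z.2)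
      (ContinuousLinearMap.fst ℝ ℝ ℝ - ContinuousLinearMap.snd ℝ ℝ ℝ) z := hasFDerivAt_fst.sub hasFDerivAt_snd
  have b1 := ((a1.add (a2.const_mul r)).add (a3.const_mul r)).mul_const (1 + r)⁻¹
  have b2 := ((a2.add (a1.const_mul r)).sub (a3.const_mul r)).mul_const (1 + r)⁻¹
  refine (b1.prodMk b2).congr_fderiv ?_
  ext <;> simp <;> ring

lemma Th_det (r : ℝ) (hr : 0 < r) (T' : ℝ → ℝ) (z : ℝ × ℝ) :
    (Th' r T' z).det = (T' z.1 * T' z.2 * (1 - r) + r * (T' z.1 + T' z.2)) / (1 + r) := by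
  have : (Th' r T' z).det = LinearMap.det (Matrix.toLin (.finTwoProd ℝ) (.finTwoProd ℝ)
    !![(T' z.1 + r) / (1 + r), (r * T' z.2 - r) / (1 + r);
       (r * T' z.1 - r) / (1 + r), (T' z.2 + r) / (1 + r)]) := rfl
  rw [this, LinearMap.det_toLin, Matrix.det_fin_two_of]
  have : 1 + r ≠ 0 := by positivity
  field_simp
  ring

lemma Th_inj (r : ℝ) (hr : 0 < r) (hr1 : r < 1) (T : ℝ → ℝ) (s : Set ℝ)
    (hT : StrictMonoOn T s) : InjOn (Th r T) (s ×ˢ s) := by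
  have aux : ∀ x y x' y', x ∈ s → y ∈ s → x' ∈ s → y' ∈ s → T x + T y = T x' + T y' →
      (1 - r) * (T x - T y) + 2 * r * (x - y) = (1 - r) * (T x' - T y') + 2 * r * (x' - y') →
      ¬ x < x' := by
    intro x y x' y' hx hy hx' hy' h1 h2 hlt
    have h3 := hT hx hx' hlt
    have h4 : T y' < T y := by linarith
    have h5 : y' < y := (hT.lt_iff_lt hy' hy).1 h4
    have h6 : 0 < (1 - r) * ((T x' - T x) + (T y - T y')) :=
      mul_pos (by linarith) (by linarith)
    have h7 : 0 < r * ((x' - x) + (y - y')) := mul_pos hr (by linarith)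
    linarith
  rintro ⟨x, y⟩ ⟨hx, hy⟩ ⟨x', y'⟩ ⟨hx', hy'⟩ h
  simp only [Th, Prod.mk.injEq] at h hx hy hx' hy'
  have hp : 1 + r ≠ 0 := by positivity
  rw [div_left_inj' hp, div_left_inj' hp] at h
  obtain ⟨h1, h2⟩ := h
  have e1 : (1 + r) * (T x + T y) = (1 + r) * (T x' + T y') := by linarith
  have e1 := mul_left_cancel₀ hp e1
  have e2 : (1 - r) * (T x - T y) + 2 * r * (x - y)
    = (1 - r) * (T x' - T y') + 2 * r * (x' - y') := by linarith
  have hxx : x = x' := le_antisymm (not_lt.1 (aux _ _ _ _ hx' hy' hx hy e1.symm e2.symm))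
    (not_lt.1 (aux _ _ _ _ hx hy hx' hy' e1 e2))
  subst hxx
  have : T y = T y' := by linarith
  rw [hT.injOn hy hy' this]

lemma amgm (r p q : ℝ) (hr : 0 < r) (hr1 : r < 1) (hp : 0 < p) (hq : 0 < q) :
    (p * q) ^ (1 / (1 + r)) ≤ (p * q * (1 - r) + r * (p + q)) / (1 + r) := by
  have h := Real.geom_mean_le_arith_mean3_weighted (w₁ := (1 - r) / (1 + r)) (w₂ := r / (1 + r))
    (w₃ := r / (1 + r)) (p₁ := p * q) (p₂ := p) (p₃ := q)
    (div_nonneg (by linarith) (by linarith)) (by positivity) (by positivity) (by positivity)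
    hp.le hq.le (by field_simp; ring)
  rw [mul_assoc, ← Real.mul_rpow hp.le hq.le, ← Real.rpow_add (by positivity)] at h
  calc _ = (p * q) ^ ((1 - r) / (1 + r) + r / (1 + r)) := by congr 1; ring
    _ ≤ _ := h
    _ = _ := by ring

noncomputable def dens (r x y : ℝ) : ℝ :=
  gaussianPDFReal 0 1 x * gaussianPDFReal (r * x) (1 - r ^ 2).toNNReal y

lemma dens_eq (r x y : ℝ) (hr : 0 < r) (hr1 : r < 1) : dens r x y =
    ((Real.sqrt (2 * Real.pi))⁻¹ * (Real.sqrt (2 * Real.pi * (1 - r ^ 2)))⁻¹) *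
      Real.exp (-(x ^ 2 + y ^ 2 - 2 * r * x * y) / (2 * (1 - r ^ 2))) := by
  have h : 0 < 1 - r ^ 2 := by nlinarith
  simp only [dens, gaussianPDFReal, Real.coe_toNNReal _ h.le]
  rw [mul_mul_mul_comm, ← Real.exp_add]
  congr 2
  · simp
  · simp; field_simp; ring

lemma pointwise (r c x y p q p' q' : ℝ) (hr : 0 < r) (hr1 : r < 1) (hc : 0 < c)
    (hp : 0 < p') (hq : 0 < q')
    (h1 : Real.exp (-x^2/2) = c * p' * Real.exp (-p^2/2))
    (h2 : Real.exp (-y^2/2) = c * q' * Real.exp (-q^2/2)) :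
    dens r x y ≤ c ^ (2 / (1 + r)) * ((p' * q' * (1 - r) + r * (p' + q')) / (1 + r) *
      dens r ((p + r * q + r * (x - y)) / (1 + r)) ((q + r * p - r * (x - y)) / (1 + r))) := by
  have h : 0 < 1 - r ^ 2 := by nlinarith
  have e1 : c * p' = Real.exp (p^2/2 - x^2/2) := by
    have := Real.exp_pos (-p^2/2)
    rw [← mul_right_cancel_iff_of_pos this, ← h1, ← Real.exp_add]; congr 1; ring
  have e2 : c * q' = Real.exp (q^2/2 - y^2/2) := by
    have := Real.exp_pos (-q^2/2)
    rw [← mul_right_cancel_iff_of_pos this, ← h2, ← Real.exp_add]; congr 1; ring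
  have e3 : c ^ (2 / (1 + r)) * (p' * q') ^ (1 / (1 + r)) =
      Real.exp ((p^2/2 - x^2/2 + (q^2/2 - y^2/2)) * (1 / (1 + r))) := by
    rw [Real.exp_mul, Real.exp_add, ← e1, ← e2,
      show c * p' * (c * q') = c ^ (2:ℝ) * (p' * q') by rw [Real.rpow_two]; ring,
      Real.mul_rpow (x := c ^ (2:ℝ)) (by positivity) (by positivity), ← Real.rpow_mul hc.le]
    congr 2; ring
  have hd : 0 ≤ dens r ((p + r * q + r * (x - y)) / (1 + r)) ((q + r * p - r * (x - y)) / (1 + r)) :=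
    mul_nonneg (gaussianPDFReal_nonneg _ _ _) (gaussianPDFReal_nonneg _ _ _)
  have hA := amgm r p' q' hr hr1 hp hq
  refine le_trans ?_ (mul_le_mul_of_nonneg_left (mul_le_mul_of_nonneg_right hA hd) (by positivity))
  rw [← mul_assoc, e3, dens_eq _ _ _ hr hr1, dens_eq _ _ _ hr hr1, mul_left_comm, ← Real.exp_add]
  apply mul_le_mul_of_nonneg_left _ (by positivity)
  apply Real.exp_le_exp.2
  have h3 : 0 < 1 - r := by linarith
  have h4 : 0 < 1 + r := by linarith
  rw [← sub_nonneg]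
  have : 0 ≤ r * (1 - r) * ((p - q) - (x - y)) ^ 2 / (1 + r) / (2 * (1 - r^2)) := by positivity
  convert this using 1
  have h5 : 1 - r ^ 2 = (1 - r) * (1 + r) := by ring
  rw [h5]
  field_simp
  ring

lemma lintegral_dens (r : ℝ) (hr : 0 < r) (hr1 : r < 1) :
    ∫⁻ z : ℝ × ℝ, ENNReal.ofReal (dens r z.1 z.2) = 1 := by
  have h : (1 - r ^ 2).toNNReal ≠ 0 := by
    have : 0 < 1 - r ^ 2 := by nlinarith
    simpa using this
  have hm : Measurable fun z : ℝ × ℝ => ENNReal.ofReal (dens r z.1 z.2) := by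
    simp only [dens, gaussianPDFReal]; fun_prop
  rw [Measure.volume_eq_prod, lintegral_prod _ hm.aemeasurable]
  have : ∀ x, ∫⁻ y, ENNReal.ofReal (dens r x y) = gaussianPDF 0 1 x := by
    intro x
    simp only [dens]
    simp_rw [ENNReal.ofReal_mul (gaussianPDFReal_nonneg _ _ _)]
    rw [lintegral_const_mul _ (by fun_prop)]
    rw [lintegral_gaussianPDFReal_eq_one _ h, mul_one]; rfl
  simp_rw [this]
  exact lintegral_gaussianPDF_eq_one 0 (by simp)

lemma map_pair (n : ℕ) (u w : Fin n → ℝ) (hu : ∑ i, u i ^ 2 = 1) (hw : ∑ i, w i ^ 2 = 1)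
    (huw : ∑ i, u i * w i = 0) :
    (Measure.pi fun _ : Fin n => gaussianReal 0 1).map
      (fun g => (∑ i, u i * g i, ∑ i, w i * g i)) = (gaussianReal 0 1).prod (gaussianReal 0 1) := by
  set P := (Measure.pi fun _ : Fin n => gaussianReal 0 1) with hP
  have hlaw : ∀ i, HasLaw (fun g : Fin n → ℝ => g i) (gaussianReal 0 1) P := fun i =>
    ⟨(measurable_pi_apply i).aemeasurable, (measurePreserving_eval (fun _ : Fin n => gaussianReal 0 1) i).map_eq⟩
  have hind : iIndepFun (fun i (g : Fin n → ℝ) => g i) P :=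
    iIndepFun_pi (X := fun _ x => x) (fun i => by fun_prop)
  have hG : ∀ i, HasGaussianLaw (fun g : Fin n → ℝ => g i) P := fun i => (hlaw i).hasGaussianLaw
  have hL : ∀ i, MemLp (fun g : Fin n → ℝ => g i) 2 P := fun i => (hG i).memLp_two
  have hjoint : HasGaussianLaw (fun g : Fin n → ℝ => g) P := hind.hasGaussianLaw hG
  have hcov : ∀ i j, cov[fun g : Fin n → ℝ => g i, fun g => g j; P] = if i = j then 1 else 0 := by
    intro i j
    split_ifs with h
    · subst h
      rw [covariance_self (measurable_pi_apply i).aemeasurable, (hlaw i).variance_eq]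
      simp
    · exact (hind.indepFun h).covariance_eq_zero (hL i) (hL j)
  have hmeas : ∀ a : Fin n → ℝ, AEMeasurable (fun g : Fin n → ℝ => ∑ i, a i * g i) P := fun a =>
    (Continuous.measurable (by fun_prop)).aemeasurable
  have hcov2 : ∀ a b : Fin n → ℝ, cov[fun g => ∑ i, a i * g i, fun g => ∑ i, b i * g i; P] =
      ∑ i, a i * b i := by
    intro a b
    rw [covariance_fun_sum_fun_sum (fun i => (hL i).const_mul _) (fun i => (hL i).const_mul _)]
    simp_rw [covariance_const_mul_left, covariance_const_mul_right, hcov]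
    simp
  have hone : ∀ a : Fin n → ℝ, ∑ i, a i ^ 2 = 1 →
      P.map (fun g => ∑ i, a i * g i) = gaussianReal 0 1 := by
    intro a ha
    have hg : HasGaussianLaw (fun g : Fin n → ℝ => ∑ i, a i * g i) P := by
      have := hjoint.map (∑ i, a i • ContinuousLinearMap.proj (R := ℝ) (φ := fun _ : Fin n => ℝ) i)
      have e : (fun g : Fin n → ℝ => ∑ i, a i * g i) =
          (⇑(∑ i, a i • ContinuousLinearMap.proj (R := ℝ) (φ := fun _ : Fin n => ℝ) i :
            (Fin n → ℝ) →L[ℝ] ℝ)) ∘ fun g => g := by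
        ext g; simp
      rw [e]; exact this
    rw [hg.map_eq_gaussianReal]
    congr 1
    · rw [integral_finsetSum _ (fun i _ => ((hL i).integrable (by norm_num)).const_mul _)]
      simp_rw [integral_const_mul, (hlaw _).integral_eq]
      simp
    · rw [← covariance_self (hmeas a), hcov2]
      simp_rw [← pow_two, ha]; simp
  have hg2 : HasGaussianLaw (fun g : Fin n → ℝ => (∑ i, u i * g i, ∑ i, w i * g i)) P := by
    have := hjoint.map ((∑ i, u i • ContinuousLinearMap.proj (R := ℝ) (φ := fun _ : Fin n => ℝ) i).prod
      (∑ i, w i • ContinuousLinearMap.proj (R := ℝ) (φ := fun _ : Fin n => ℝ) i))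
    have e : (fun g : Fin n → ℝ => (∑ i, u i * g i, ∑ i, w i * g i)) =
        ((∑ i, u i • ContinuousLinearMap.proj (R := ℝ) (φ := fun _ : Fin n => ℝ) i).prod
      (∑ i, w i • ContinuousLinearMap.proj (R := ℝ) (φ := fun _ : Fin n => ℝ) i)) ∘ fun g => g := by
      ext g <;> simp
    rw [e]; exact this
  have hI := hg2.indepFun_of_covariance_eq_zero (by rw [hcov2, huw])
  rw [(indepFun_iff_map_prod_eq_prod_map_map (hmeas u) (hmeas w)).1 hI, hone u hu, hone w hw]

lemma prod_formula (r t : ℝ) (hr : 0 < r) (hr1 : r < 1) :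
    ((gaussianReal 0 1).prod (gaussianReal 0 1))
      {z : ℝ × ℝ | t ≤ z.1 ∧ t ≤ r * z.1 + Real.sqrt (1 - r ^ 2) * z.2} =
    ∫⁻ z in Ioi t ×ˢ Ioi t, ENNReal.ofReal (dens r z.1 z.2) := by
  have hpos : 0 < 1 - r ^ 2 := by nlinarith
  have h : (1 - r ^ 2).toNNReal ≠ 0 := by simpa using hpos
  have hm : Measurable fun z : ℝ × ℝ => ENNReal.ofReal (dens r z.1 z.2) := by
    simp only [dens, gaussianPDFReal]; fun_prop
  have hS : MeasurableSet
      {z : ℝ × ℝ | t ≤ z.1 ∧ t ≤ r * z.1 + Real.sqrt (1 - r ^ 2) * z.2} := by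
    rw [Set.ofPred_and]
    exact MeasurableSet.inter (measurableSet_le measurable_const measurable_fst)
      (measurableSet_le measurable_const (by fun_prop))
  have inner : ∀ x, (gaussianReal 0 1) {z | t ≤ r * x + Real.sqrt (1 - r ^ 2) * z} =
      ∫⁻ y in Ioi t, gaussianPDF (r * x) (1 - r ^ 2).toNNReal y := by
    intro x
    have e : gaussianReal (r * x) (1 - r ^ 2).toNNReal =
        (gaussianReal 0 1).map (fun z => r * x + Real.sqrt (1 - r ^ 2) * z) := by
      have h1 := gaussianReal_map_const_mul (μ := 0) (v := 1) (Real.sqrt (1 - r ^ 2))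
      have h2 := gaussianReal_map_const_add (μ := Real.sqrt (1 - r ^ 2) * 0)
        (v := NNReal.mk ((Real.sqrt (1 - r ^ 2)) ^ 2) (sq_nonneg _) * 1) (r * x)
      rw [← h1, Measure.map_map (by fun_prop) (by fun_prop)] at h2
      refine Eq.trans ?_ h2.symm
      congr 1
      · simp
      · ext; simp [Real.sq_sqrt hpos.le, hpos.le]
    rw [Measure.restrict_congr_set Ioi_ae_eq_Ici, ← gaussianReal_apply _ h, e,
      Measure.map_apply (by fun_prop) measurableSet_Ici]
    rfl
  have hres : volume.restrict (Ioi t ×ˢ Ioi t) =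
      (volume.restrict (Ioi t)).prod (volume.restrict (Ioi t)) := by
    rw [Measure.volume_eq_prod, Measure.prod_restrict]
  rw [Measure.prod_apply hS, hres, lintegral_prod _ hm.aemeasurable]
  have e1 : ∀ x, (gaussianReal 0 1) (Prod.mk x ⁻¹'
      {z : ℝ × ℝ | t ≤ z.1 ∧ t ≤ r * z.1 + Real.sqrt (1 - r ^ 2) * z.2}) =
      (Ici t).indicator (fun x => ∫⁻ y in Ioi t, gaussianPDF (r * x) (1 - r ^ 2).toNNReal y) x := by
    intro x
    by_cases hx : t ≤ x
    · rw [indicator_of_mem (show x ∈ Ici t from hx), ← inner]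
      simp [hx]
    · rw [indicator_of_notMem (show x ∉ Ici t from hx)]
      simp [hx]
  simp_rw [e1]
  have hm2 : Measurable fun x => ∫⁻ y in Ioi t, gaussianPDF (r * x) (1 - r ^ 2).toNNReal y := by
    have hm3 : Measurable fun z : ℝ × ℝ => gaussianPDF (r * z.1) (1 - r ^ 2).toNNReal z.2 := by
      simp only [gaussianPDF, gaussianPDFReal]; fun_prop
    exact hm3.lintegral_prod_right'
  rw [lintegral_indicator measurableSet_Ici, gaussianReal_of_var_ne_zero 0 one_ne_zero,
    setLIntegral_withDensity_eq_setLIntegral_mul _ (measurable_gaussianPDF 0 1) hm2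
      measurableSet_Ici, ← Measure.restrict_congr_set Ioi_ae_eq_Ici]
  congr 1
  ext x
  simp only [Pi.mul_apply, dens]
  simp_rw [ENNReal.ofReal_mul (gaussianPDFReal_nonneg _ _ _)]
  rw [lintegral_const_mul _ (by fun_prop)]
  rfl

lemma core (r t : ℝ) (hr : 0 < r) (hr1 : r < 1) :
    ((gaussianReal 0 1).prod (gaussianReal 0 1))
      {z : ℝ × ℝ | t ≤ z.1 ∧ t ≤ r * z.1 + Real.sqrt (1 - r ^ 2) * z.2} ≤
    (gaussianReal 0 1 {x | t ≤ x}) ^ (2 / (1 + r)) := by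
  rw [prod_formula r t hr hr1]
  obtain ⟨T, T', hT, hd⟩ := transport t
  set c := 1 - cdf (gaussianReal 0 1) t with hcdef
  have hc : 0 < c := sub_pos.2 (cdf_lt_one' t)
  have hcm : gaussianReal 0 1 {x | t ≤ x} = ENNReal.ofReal c := by
    have : NullSingletonClass (gaussianReal 0 1) := nullSingletonClass_gaussianReal one_ne_zero
    change gaussianReal 0 1 (Ici t) = _
    rw [← measure_congr (Ioi_ae_eq_Ici (μ := gaussianReal 0 1)), ← compl_Iic,
      prob_compl_eq_one_sub measurableSet_Iic, ← ofReal_cdf, hcdef,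
      ENNReal.ofReal_sub _ (cdf_nonneg _ _), ENNReal.ofReal_one]
  rw [hcm, ENNReal.ofReal_rpow_of_pos hc]
  have hms : MeasurableSet (Ioi t ×ˢ Ioi t) := measurableSet_Ioi.prod measurableSet_Ioi
  calc ∫⁻ z in Ioi t ×ˢ Ioi t, ENNReal.ofReal (dens r z.1 z.2)
      ≤ ∫⁻ z in Ioi t ×ˢ Ioi t, ENNReal.ofReal (c ^ (2 / (1 + r))) *
        (ENNReal.ofReal |(Th' r T' z).det| *
          ENNReal.ofReal (dens r (Th r T z).1 (Th r T z).2)) := by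
        apply setLIntegral_mono' hms
        rintro ⟨x, y⟩ ⟨hx, hy⟩
        obtain ⟨-, hp, h1⟩ := hd x hx
        obtain ⟨-, hq, h2⟩ := hd y hy
        have := pointwise r c x y (T x) (T y) (T' x) (T' y) hr hr1 hc hp hq h1 h2
        rw [← ENNReal.ofReal_mul (abs_nonneg _), ← ENNReal.ofReal_mul (by positivity)]
        apply ENNReal.ofReal_le_ofReal
        rw [Th_det r hr, abs_of_nonneg]
        · exact this
        · have : 0 < 1 - r := by linarith
          positivity
    _ = ENNReal.ofReal (c ^ (2 / (1 + r))) * ∫⁻ z in Ioi t ×ˢ Ioi t,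
        (ENNReal.ofReal |(Th' r T' z).det| *
          ENNReal.ofReal (dens r (Th r T z).1 (Th r T z).2)) :=
        lintegral_const_mul' _ _ ENNReal.ofReal_ne_top
    _ = ENNReal.ofReal (c ^ (2 / (1 + r))) * ∫⁻ z in Th r T '' (Ioi t ×ˢ Ioi t),
          ENNReal.ofReal (dens r z.1 z.2) := by
        rw [lintegral_image_eq_lintegral_abs_det_fderiv_mul volume hms
          (fun z hz => (Th_deriv r T T' z (hd _ hz.1).1 (hd _ hz.2).1).hasFDerivWithinAt)
          (Th_inj r hr hr1 T _ hT)]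
    _ ≤ ENNReal.ofReal (c ^ (2 / (1 + r))) * ∫⁻ z : ℝ × ℝ, ENNReal.ofReal (dens r z.1 z.2) := by
        gcongr
        exact Measure.restrict_le_self
    _ = _ := by rw [lintegral_dens r hr hr1, mul_one]

end Aux

theorem stmt15 (n : ℕ) (β t : ℝ) (hβ : β ∈ Set.Ioo (0 : ℝ) 1) (ht : 0 < t)
    (u v : Fin n → ℝ)
    (hu : ∑ i, u i ^ 2 = 1) (hv : ∑ i, v i ^ 2 = 1)
    (huv : ∑ i, u i * v i ≤ β) :
    (Measure.pi fun _ : Fin n => gaussianReal 0 1)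
        {γ | t ≤ ∑ i, u i * γ i ∧ t ≤ ∑ i, v i * γ i} ≤
      (gaussianReal 0 1 {x | t ≤ x}) ^ (2 / (1 + β)) := by
  obtain ⟨hβ0, hβ1⟩ := hβ
  set r := ∑ i, u i * v i with hr
  have hone : gaussianReal 0 1 {x | t ≤ x} ≤ 1 := prob_le_one
  -- the lower bound on the correlation
  have hsq : ∑ i, (u i + v i) ^ 2 = 2 + 2 * r := by
    have : ∀ i, (u i + v i) ^ 2 = u i ^ 2 + v i ^ 2 + 2 * (u i * v i) := fun i => by ring
    simp_rw [this, Finset.sum_add_distrib, ← Finset.mul_sum, hu, hv]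
    ring
  have hr_ge : -1 ≤ r := by
    have : 0 ≤ ∑ i, (u i + v i) ^ 2 := Finset.sum_nonneg fun i _ => sq_nonneg _
    linarith
  rcases hr_ge.eq_or_lt with hm1 | hgt
  · have h0 : ∑ i, (u i + v i) ^ 2 = 0 := by rw [hsq, ← hm1]; ring
    rw [Finset.sum_eq_zero_iff_of_nonneg (fun i _ => sq_nonneg _)] at h0
    have hvu : ∀ i, v i = - u i := fun i => by
      have := pow_eq_zero_iff (two_ne_zero) |>.1 (h0 i (Finset.mem_univ i))
      linarith
    have : {γ : Fin n → ℝ | t ≤ ∑ i, u i * γ i ∧ t ≤ ∑ i, v i * γ i} = ∅ := by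
      ext γ
      simp only [Set.mem_ofPred_eq, Set.mem_empty_iff_false, iff_false, not_and, hvu, neg_mul,
        Finset.sum_neg_distrib]
      intro h1 h2
      linarith
    rw [this]; simp
  have hr1 : r < 1 := by linarith
  have hpos : 0 < 1 - r ^ 2 := by nlinarith
  set s := Real.sqrt (1 - r ^ 2) with hs
  have hs0 : 0 < s := Real.sqrt_pos.2 hpos
  have hs2 : s ^ 2 = 1 - r ^ 2 := Real.sq_sqrt hpos.le
  set w : Fin n → ℝ := fun i => (v i - r * u i) / s with hwdef
  have hww : ∑ i, w i ^ 2 = 1 := by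
    have : ∀ i, w i ^ 2 = (v i ^ 2 - 2 * r * (u i * v i) + r ^ 2 * u i ^ 2) / s ^ 2 := fun i => by
      simp only [hwdef]; ring
    simp_rw [this]
    rw [← Finset.sum_div, Finset.sum_add_distrib, Finset.sum_sub_distrib, ← Finset.mul_sum,
      ← Finset.mul_sum, hu, hv, ← hr, hs2, div_eq_one_iff_eq hpos.ne']
    ring
  have huw : ∑ i, u i * w i = 0 := by
    have : ∀ i, u i * w i = (u i * v i - r * u i ^ 2) / s := fun i => by
      simp only [hwdef]; ring
    simp_rw [this]
    rw [← Finset.sum_div, Finset.sum_sub_distrib, ← Finset.mul_sum, hu, ← hr]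
    simp
  have hvw : ∀ g : Fin n → ℝ, ∑ i, v i * g i = r * ∑ i, u i * g i + s * ∑ i, w i * g i := by
    intro g
    rw [Finset.mul_sum, Finset.mul_sum, ← Finset.sum_add_distrib]
    refine Finset.sum_congr rfl fun i _ => ?_
    simp only [hwdef]
    field_simp
    ring
  have hS : MeasurableSet {z : ℝ × ℝ | t ≤ z.1 ∧ t ≤ r * z.1 + s * z.2} := by
    rw [Set.ofPred_and]
    exact MeasurableSet.inter (measurableSet_le measurable_const measurable_fst)
      (measurableSet_le measurable_const (by fun_prop))
  have hmain : (Measure.pi fun _ : Fin n => gaussianReal 0 1)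
        {γ | t ≤ ∑ i, u i * γ i ∧ t ≤ ∑ i, v i * γ i} =
      ((gaussianReal 0 1).prod (gaussianReal 0 1))
        {z : ℝ × ℝ | t ≤ z.1 ∧ t ≤ r * z.1 + s * z.2} := by
    rw [← map_pair n u w hu hww huw, Measure.map_apply _ hS]
    · simp_rw [hvw]; rfl
    · exact Continuous.measurable (by fun_prop)
  rw [hmain]
  rcases le_or_gt r 0 with hr0 | hr0
  · calc ((gaussianReal 0 1).prod (gaussianReal 0 1))
          {z : ℝ × ℝ | t ≤ z.1 ∧ t ≤ r * z.1 + s * z.2}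
        ≤ ((gaussianReal 0 1).prod (gaussianReal 0 1)) ({x | t ≤ x} ×ˢ {x | t ≤ x}) := by
          apply measure_mono
          rintro ⟨x, z⟩ ⟨hx, hz⟩
          simp only at hx hz
          refine ⟨hx, ?_⟩
          change t ≤ z
          have h1 : t * (1 - r) ≤ s * z := by nlinarith
          have h2 : s ≤ 1 - r := by
            apply Real.sqrt_le_iff.2
            constructor
            · linarith
            · nlinarith
          have h3 : t * s ≤ z * s := by nlinarith
          exact le_of_mul_le_mul_right h3 hs0
      _ = (gaussianReal 0 1 {x | t ≤ x}) ^ (2 : ℝ) := by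
          rw [Measure.prod_prod, ENNReal.rpow_two, sq]
      _ ≤ _ := by
          apply ENNReal.rpow_le_rpow_of_exponent_ge hone
          rw [div_le_iff₀ (by linarith)]
          linarith
  · refine (core r t hr0 hr1).trans (ENNReal.rpow_le_rpow_of_exponent_ge hone ?_)
    gcongr
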